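/- Let λ, η ∈ (0,1] with λ < 1, and for T ≥ 1 define p(T) = λ·[1 + Σ_{k=2}^{T} Σ_{j=2}^{k} C(k-2, j-2)·((1-λ)·η)^{j-1}·(1-η)^{k-j}]. Then p(T) → 1 as T → ∞; equivalently, the probability 1 - p(T) of missing the stable pose tends to 0. -/

import Mathlib

open Finset Filter

/-- Binomial theorem with both indices shifted by two. -/
theorem sum_Icc_two_choose_mul_pow {R : Type*} [CommSemiring R] (a b : R) (n : ℕ) :
    ∑ j ∈ Finset.Icc 2 (n + 2),
      (Nat.choose (n + 2 - 2) (j - 2) : R) * a ^ (j - 1) * b ^ (n + 2 - j)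
      = a * (a + b) ^ n := by
  rw [← Finset.Ico_add_one_right_eq_Icc, Finset.sum_Ico_eq_sum_range, add_pow, Finset.mul_sum,
    show n + 2 + 1 - 2 = n + 1 by omega]
  refine Finset.sum_congr rfl fun m _ => ?_
  rw [show 2 + m - 2 = m by omega, show 2 + m - 1 = m + 1 by omega,
    show n + 2 - (2 + m) = n - m by omega, Nat.add_sub_cancel]
  ring

/-- Closed form of the pose-coverage formula. -/
theorem pose_coverage_closed_form (lam eta : ℝ) (n : ℕ) :
    lam * (1 + ∑ k ∈ Finset.Icc 2 (n + 1), ∑ j ∈ Finset.Icc 2 k,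
        (Nat.choose (k - 2) (j - 2) : ℝ) * ((1 - lam) * eta) ^ (j - 1)
          * (1 - eta) ^ (k - j))
      = 1 - (1 - lam) * (1 - lam * eta) ^ n := by
  induction n with
  | zero => simp
  | succ n ih =>
    rw [Finset.sum_Icc_succ_top (by omega), ← add_assoc, mul_add, ih,
      sum_Icc_two_choose_mul_pow,
      show (1 - lam) * eta + (1 - eta) = 1 - lam * eta by ring]
    ring

/-- If `lam ∈ (0,1)` and `eta ∈ (0,1]`, the encounter probability `p T` of the
stable pose within `T` steps, given by the pose-coverage formula, tends to `1`
as `T → ∞`; equivalently, the probability `1 - p T` of missing the pose tends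
to `0`. -/
theorem pose_coverage_tendsto_one
    (lam eta : ℝ) (hlam : lam ∈ Set.Ioc (0:ℝ) 1) (hlam1 : lam < 1)
    (heta : eta ∈ Set.Ioc (0:ℝ) 1)
    (p : ℕ → ℝ)
    (hp : ∀ T : ℕ, 1 ≤ T →
      p T = lam * (1 + ∑ k ∈ Finset.Icc 2 T, ∑ j ∈ Finset.Icc 2 k,
        (Nat.choose (k - 2) (j - 2) : ℝ) * ((1 - lam) * eta) ^ (j - 1)
          * (1 - eta) ^ (k - j))) :
    Tendsto p atTop (nhds 1) ∧ Tendsto (fun T => 1 - p T) atTop (nhds 0) := by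
  obtain ⟨hl, -⟩ := hlam
  obtain ⟨he, he1⟩ := heta
  have hpow : Tendsto (fun n : ℕ => (1 - lam * eta) ^ n) atTop (nhds 0) :=
    tendsto_pow_atTop_nhds_zero_of_lt_one (by nlinarith) (by nlinarith)
  have hlim : Tendsto p atTop (nhds 1) := by
    rw [← tendsto_add_atTop_iff_nat 1]
    have h := (hpow.const_mul (1 - lam)).const_sub 1
    rw [mul_zero, sub_zero] at h
    refine h.congr fun n => ?_
    rw [hp (n + 1) (by omega), pose_coverage_closed_form]
  exact ⟨hlim, by simpa using hlim.const_sub 1⟩
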